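/- For every n ≥ 4, the number of simple permutations of length n in 𝒜 whose second entry is not 1 (π(2) ≠ 1) equals (3^{n−3} + (−1)^n)/4; equivalently, four times this number equals 3^{n−3} + (−1)^n. -/

import Mathlib

/-- `σ` is contained in `π` as a pattern. -/
def Contains {k n : ℕ} (σ : Equiv.Perm (Fin k)) (π : Equiv.Perm (Fin n)) : Prop :=
  ∃ f : Fin k → Fin n, StrictMono f ∧ ∀ i j : Fin k, σ i < σ j ↔ π (f i) < π (f j)

/-- `π` avoids the pattern `σ`. -/
def Avoids {k n : ℕ} (σ : Equiv.Perm (Fin k)) (π : Equiv.Perm (Fin n)) : Prop :=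
  ¬ Contains σ π

/-- The permutation 4231 (0-indexed values). -/
noncomputable def p4231 : Equiv.Perm (Fin 4) := Equiv.ofBijective ![3,1,2,0] (by decide)

/-- The permutation 35142 (0-indexed values). -/
noncomputable def p35142 : Equiv.Perm (Fin 5) := Equiv.ofBijective ![2,4,0,3,1] (by decide)

/-- The permutation 42513 (0-indexed values). -/
noncomputable def p42513 : Equiv.Perm (Fin 5) := Equiv.ofBijective ![3,1,4,0,2] (by decide)

/-- The permutation 351624 (0-indexed values). -/
noncomputable def p351624 : Equiv.Perm (Fin 6) := Equiv.ofBijective ![2,4,0,5,1,3] (by decide)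

/-- Membership in the class 𝒜 = Av(4231, 35142, 42513, 351624). -/
def InA {n : ℕ} (π : Equiv.Perm (Fin n)) : Prop :=
  Avoids p4231 π ∧ Avoids p35142 π ∧ Avoids p42513 π ∧ Avoids p351624 π

/-- `s` is an interval of `π`: a set of consecutive positions whose image
under `π` is a set of consecutive values. -/
def IsPermInterval {n : ℕ} (π : Equiv.Perm (Fin n)) (s : Finset (Fin n)) : Prop :=
  (∀ a ∈ s, ∀ b ∈ s, ∀ j : Fin n, a ≤ j → j ≤ b → j ∈ s) ∧
  (∀ a ∈ s, ∀ b ∈ s, ∀ j : Fin n, π a ≤ π j → π j ≤ π b → j ∈ s)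

/-- `π` is simple: its only intervals are singletons (or empty) and the whole domain. -/
def IsSimple {n : ℕ} (π : Equiv.Perm (Fin n)) : Prop :=
  ∀ s : Finset (Fin n), IsPermInterval π s → s.card ≤ 1 ∨ s = Finset.univ

/-- The reverse complement of a permutation. -/
def revComp {n : ℕ} (π : Equiv.Perm (Fin n)) : Equiv.Perm (Fin n) :=
  (Fin.revPerm.trans π).trans Fin.revPerm

/-- The skew sum `σ ⊖ τ`. -/
def skewSum {m k : ℕ} (σ : Equiv.Perm (Fin m)) (τ : Equiv.Perm (Fin k)) :
    Equiv.Perm (Fin (m + k)) :=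
  finSumFinEquiv.symm.trans ((Equiv.sumCongr σ τ).trans
    ((Equiv.sumComm (Fin m) (Fin k)).trans (finSumFinEquiv.trans (finCongr (Nat.add_comm k m)))))

/-- The direct sum `α ⊕ β`. -/
def directSum {m k : ℕ} (α : Equiv.Perm (Fin m)) (β : Equiv.Perm (Fin k)) :
    Equiv.Perm (Fin (m + k)) :=
  finSumFinEquiv.symm.trans ((Equiv.sumCongr α β).trans finSumFinEquiv)

/-- The permutation 312 (0-indexed values). -/
noncomputable def p312 : Equiv.Perm (Fin 3) := Equiv.ofBijective ![2,0,1] (by decide)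

/-- The permutation 231 (0-indexed values). -/
noncomputable def p231 : Equiv.Perm (Fin 3) := Equiv.ofBijective ![1,2,0] (by decide)

/-- The number of simple permutations of length `n` in the class 𝒜. -/
noncomputable def simpleCount (n : ℕ) : ℕ :=
  Nat.card {π : Equiv.Perm (Fin n) // IsSimple π ∧ InA π}

section SimpleCriteria

variable {n : ℕ} {π : Equiv.Perm (Fin n)}

/-- A set of positions that is convex in position and in value exhausts a simple permutation
as soon as it has two elements. -/
theorem IsSimple.forall_mem (h : IsSimple π) (P : Fin n → Prop)
    (hpos : ∀ a b j, P a → P b → a ≤ j → j ≤ b → P j)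
    (hval : ∀ a b j, P a → P b → π a ≤ π j → π j ≤ π b → P j)
    {a b : Fin n} (ha : P a) (hb : P b) (hab : a ≠ b) (c : Fin n) : P c := by
  classical
  have hmem : ∀ x, x ∈ Finset.univ.filter P ↔ P x := by simp
  have hinterval : IsPermInterval π (Finset.univ.filter P) := by
    constructor
    · intro a ha b hb j h1 h2
      rw [hmem] at *
      exact hpos a b j ha hb h1 h2
    · intro a ha b hb j h1 h2
      rw [hmem] at *
      exact hval a b j ha hb h1 h2
  rcases h _ hinterval with h1 | h1
  · exact absurd (Finset.card_le_one.mp h1 a ((hmem a).2 ha) b ((hmem b).2 hb)) hab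
  · rw [← hmem, h1]
    exact Finset.mem_univ c

/-- An interval of a simple permutation given by its bounds `a < b` in position and `c`, `d`
in value occupies all positions. -/
theorem IsSimple.bounds (h : IsSimple π) {a b c d : ℕ} (hab : a < b) (hb : b < n)
    (H : ∀ i : Fin n, (a ≤ (i : ℕ) ∧ (i : ℕ) ≤ b) ↔ (c ≤ (π i : ℕ) ∧ (π i : ℕ) ≤ d)) :
    a = 0 ∧ b + 1 = n := by
  have key := h.forall_mem (fun i => a ≤ (i : ℕ) ∧ (i : ℕ) ≤ b)
    (fun x y j hx hy h1 h2 => by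
      rw [Fin.le_def] at h1 h2
      omega)
    (fun x y j hx hy h1 h2 => by
      rw [Fin.le_def] at h1 h2
      have := H x
      have := H y
      have := H j
      omega)
    (a := ⟨a, by omega⟩) (b := ⟨b, hb⟩) ⟨le_rfl, hab.le⟩ ⟨hab.le, le_rfl⟩
    (by simp only [ne_eq, Fin.mk.injEq]; omega)
  have h0 := (key ⟨0, by omega⟩).1
  have h1 := (key ⟨n - 1, by omega⟩).2
  simp only at h0 h1
  omega

theorem isSimple_of_bounds
    (H : ∀ a b c d : ℕ, a < b → b < n → c < d →
      (∀ i : Fin n, (a ≤ (i : ℕ) ∧ (i : ℕ) ≤ b) ↔ (c ≤ (π i : ℕ) ∧ (π i : ℕ) ≤ d)) →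
      a = 0 ∧ b + 1 = n) : IsSimple π := by
  intro s hs
  by_contra! hcon
  obtain ⟨hcard, hne⟩ := hcon
  obtain ⟨x, hx, y, hy, hxy⟩ := Finset.one_lt_card.mp hcard
  have hs' : s.Nonempty := ⟨x, hx⟩
  obtain ⟨a, ha, hamin⟩ := s.exists_min_image id hs'
  obtain ⟨b, hb, hbmax⟩ := s.exists_max_image id hs'
  obtain ⟨c, hc, hcmin⟩ := s.exists_min_image π hs'
  obtain ⟨d, hd, hdmax⟩ := s.exists_max_image π hs'
  simp only [id] at hamin hbmax
  have hlt : ((a : ℕ) < b) := by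
    have h1 := hamin x hx
    have h2 := hamin y hy
    have h3 := hbmax x hx
    have h4 := hbmax y hy
    rw [Fin.le_def] at h1 h2 h3 h4
    have : (x : ℕ) ≠ y := fun h => hxy (Fin.ext h)
    omega
  have hlt' : ((π c : ℕ) < π d) := by
    have h1 := hcmin x hx
    have h2 := hcmin y hy
    have h3 := hdmax x hx
    have h4 := hdmax y hy
    rw [Fin.le_def] at h1 h2 h3 h4
    have : (π x : ℕ) ≠ π y := fun h => hxy (π.injective (Fin.ext h))
    omega
  have hmem : ∀ i : Fin n, ((a : ℕ) ≤ i ∧ (i : ℕ) ≤ b) ↔ i ∈ s := fun i =>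
    ⟨fun h => hs.1 a ha b hb i h.1 h.2, fun h => ⟨hamin i h, hbmax i h⟩⟩
  have hmem' : ∀ i : Fin n, ((π c : ℕ) ≤ π i ∧ (π i : ℕ) ≤ π d) ↔ i ∈ s := fun i =>
    ⟨fun h => hs.2 c hc d hd i h.1 h.2, fun h => ⟨hcmin i h, hdmax i h⟩⟩
  obtain ⟨h0, h1⟩ := H a b (π c) (π d) hlt b.2 hlt' fun i => (hmem i).trans (hmem' i).symm
  refine hne (Finset.eq_univ_iff_forall.mpr fun i => (hmem i).mp ?_)
  have := i.2
  omega

theorem IsSimple.symm (h : IsSimple π) : IsSimple π.symm := by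
  refine isSimple_of_bounds fun a b c d hab hb hcd H => ?_
  have key := h.forall_mem (fun i => a ≤ (π i : ℕ) ∧ (π i : ℕ) ≤ b)
    (fun x y j hx hy h1 h2 => by
      have h3 := H (π x)
      have h4 := H (π y)
      have h5 := H (π j)
      simp only [Equiv.symm_apply_apply] at h3 h4 h5
      rw [Fin.le_def] at h1 h2
      omega)
    (fun x y j hx hy h1 h2 => by
      rw [Fin.le_def] at h1 h2
      omega)
    (a := π.symm ⟨a, by omega⟩) (b := π.symm ⟨b, hb⟩) (by simp; omega) (by simp; omega)
    (by simp only [ne_eq, EmbeddingLike.apply_eq_iff_eq, Fin.mk.injEq]; omega)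
  have h0 := (key (π.symm ⟨0, by omega⟩)).1
  have h1 := (key (π.symm ⟨n - 1, by omega⟩)).2
  simp only [Equiv.apply_symm_apply] at h0 h1
  omega

end SimpleCriteria

section InsertPoint

variable {n : ℕ}

/-- Insert the point at position `p` with value `v` into the permutation `σ`. -/
def insertPoint (p v : Fin (n + 1)) (σ : Equiv.Perm (Fin n)) : Equiv.Perm (Fin (n + 1)) :=
  (finSuccEquiv' p).trans ((Equiv.optionCongr σ).trans (finSuccEquiv' v).symm)

@[simp]
theorem insertPoint_self (p v : Fin (n + 1)) (σ : Equiv.Perm (Fin n)) :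
    insertPoint p v σ p = v := by
  simp [insertPoint]

@[simp]
theorem insertPoint_succAbove (p v : Fin (n + 1)) (σ : Equiv.Perm (Fin n)) (i : Fin n) :
    insertPoint p v σ (p.succAbove i) = v.succAbove (σ i) := by
  simp [insertPoint]

theorem exists_eq_insertPoint {π : Equiv.Perm (Fin (n + 1))} {p v : Fin (n + 1)} (h : π p = v) :
    ∃ σ, π = insertPoint p v σ := by
  subst h
  refine ⟨(finSuccAboveEquiv p).trans ((π.subtypeEquiv (p := (· ≠ p)) (q := (· ≠ π p)) ?_).trans
    (finSuccAboveEquiv (π p)).symm), ?_⟩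
  · simp
  · ext x
    rcases Fin.eq_self_or_eq_succAbove p x with rfl | ⟨i, rfl⟩
    · simp
    · have := congrArg Subtype.val ((finSuccAboveEquiv (π p)).apply_symm_apply
        ⟨π (p.succAbove i), by simp⟩)
      rw [finSuccAboveEquiv_apply] at this
      simp only [insertPoint_succAbove]
      exact congrArg Fin.val this.symm

theorem insertPoint_inj {p q v : Fin (n + 1)} {σ τ : Equiv.Perm (Fin n)}
    (h : insertPoint p v σ = insertPoint q v τ) : p = q ∧ σ = τ := by
  have hpq : p = q := by
    apply (insertPoint q v τ).injective
    rw [insertPoint_self, ← h, insertPoint_self]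
  subst hpq
  refine ⟨rfl, Equiv.ext fun i => ?_⟩
  have := congrArg (fun e => e (p.succAbove i)) h
  simpa using this

theorem val_succAbove (p : Fin (n + 1)) (i : Fin n) :
    (p.succAbove i : ℕ) = if (i : ℕ) < p then (i : ℕ) else i + 1 := by
  rcases lt_or_ge (i : ℕ) (p : ℕ) with h | h
  · rw [Fin.succAbove_of_castSucc_lt _ _ h, if_pos h, Fin.val_castSucc]
  · rw [Fin.succAbove_of_le_castSucc _ _ h, if_neg (by omega), Fin.val_succ]

theorem exists_apply_val (σ : Equiv.Perm (Fin n)) {v : ℕ} (hv : v < n) :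
    ∃ i, (σ i : ℕ) = v :=
  ⟨σ.symm ⟨v, hv⟩, by simp⟩

theorem eq_of_apply_val (σ : Equiv.Perm (Fin n)) {i j : Fin n} (h : (σ i : ℕ) = σ j) : i = j :=
  σ.injective (Fin.ext h)

/-- Inserting a point into a simple permutation gives a simple permutation, provided the point
has an interior value and does not form an interval with a neighbour. -/
theorem IsSimple.insertPoint {σ : Equiv.Perm (Fin n)} (h : IsSimple σ) {p v : Fin (n + 1)}
    (hv0 : 0 < (v : ℕ)) (hvn : (v : ℕ) < n)
    (hadj : ∀ i : Fin n, ((p : ℕ) = i + 1 ∨ (p : ℕ) = i) →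
      (v : ℕ) ≠ σ i + 1 ∧ (v : ℕ) ≠ σ i) :
    IsSimple (_root_.insertPoint p v σ) := by
  refine isSimple_of_bounds fun a b c d hab hb hcd H => ?_
  have Hp := H p
  rw [insertPoint_self] at Hp
  have Hs : ∀ i : Fin n, _ := fun i => H (p.succAbove i)
  simp only [insertPoint_succAbove, val_succAbove] at Hs
  have hp := p.2
  have hv := v.2
  by_cases hlt : b = a + 1 ∧ ((p : ℕ) = a ∨ (p : ℕ) = b)
  · exfalso
    obtain ⟨rfl, hpa⟩ := hlt
    have hvcd : c ≤ (v : ℕ) ∧ (v : ℕ) ≤ d := Hp.mp (by omega)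
    have hi : ∃ i : Fin n, (i : ℕ) = a := ⟨⟨a, by omega⟩, rfl⟩
    obtain ⟨i, hi⟩ := hi
    have h1 := hadj i (by omega)
    have h2 := Hs i
    obtain ⟨j, hj⟩ := exists_apply_val σ (v := if (σ i : ℕ) < v then v - 1 else v)
      (by have := (σ i).2; split_ifs <;> omega)
    have h3 := Hs j
    have hij : (i : ℕ) = j := by split_ifs at h2 h3 hj <;> omega
    have : i = j := Fin.ext hij
    subst this
    split_ifs at hj <;> omega
  · have key := h.bounds (a := if a ≤ (p : ℕ) then a else a - 1)
      (b := if b < (p : ℕ) then b else b - 1)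
      (c := if c ≤ (v : ℕ) then c else c - 1)
      (d := if d < (v : ℕ) then d else d - 1)
      (by split_ifs <;> omega) (by split_ifs <;> omega)
      (fun i => by
        have := Hs i
        split_ifs at this ⊢ <;> omega)
    obtain ⟨j, hj⟩ := exists_apply_val σ (v := v - 1) (by omega)
    obtain ⟨l, hl⟩ := exists_apply_val σ (v := v) (by omega)
    have hj' := Hs j
    have hl' := Hs l
    have := j.2
    have := l.2
    split_ifs at key hj' hl' <;> omega

end InsertPoint

section Patterns

theorem InA.not_4231 {n : ℕ} {π : Equiv.Perm (Fin n)} (h : InA π) {a b c d : Fin n}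
    (hab : a < b) (hbc : b < c) (hcd : c < d)
    (h1 : π d < π b) (h2 : π b < π c) (h3 : π c < π a) : False := by
  refine h.1 ⟨![a, b, c, d], ?_, fun i j => ?_⟩
  · rw [Fin.strictMono_iff_lt_succ]
    intro i
    fin_cases i <;> assumption
  · simp only [p4231, Equiv.ofBijective_apply]
    fin_cases i <;> fin_cases j <;> simp <;> order

theorem InA.not_35142 {n : ℕ} {π : Equiv.Perm (Fin n)} (h : InA π) {a b c d e : Fin n}
    (hab : a < b) (hbc : b < c) (hcd : c < d) (hde : d < e)
    (h1 : π c < π e) (h2 : π e < π a) (h3 : π a < π d) (h4 : π d < π b) : False := by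
  refine h.2.1 ⟨![a, b, c, d, e], ?_, fun i j => ?_⟩
  · rw [Fin.strictMono_iff_lt_succ]
    intro i
    fin_cases i <;> assumption
  · simp only [p35142, Equiv.ofBijective_apply]
    fin_cases i <;> fin_cases j <;> simp <;> order

theorem InA.not_42513 {n : ℕ} {π : Equiv.Perm (Fin n)} (h : InA π) {a b c d e : Fin n}
    (hab : a < b) (hbc : b < c) (hcd : c < d) (hde : d < e)
    (h1 : π d < π b) (h2 : π b < π e) (h3 : π e < π a) (h4 : π a < π c) : False := by
  refine h.2.2.1 ⟨![a, b, c, d, e], ?_, fun i j => ?_⟩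
  · rw [Fin.strictMono_iff_lt_succ]
    intro i
    fin_cases i <;> assumption
  · simp only [p42513, Equiv.ofBijective_apply]
    fin_cases i <;> fin_cases j <;> simp <;> order

theorem InA.not_351624 {n : ℕ} {π : Equiv.Perm (Fin n)} (h : InA π) {a b c d e f : Fin n}
    (hab : a < b) (hbc : b < c) (hcd : c < d) (hde : d < e) (hef : e < f)
    (h1 : π c < π e) (h2 : π e < π a) (h3 : π a < π f) (h4 : π f < π b) (h5 : π b < π d) :
    False := by
  refine h.2.2.2 ⟨![a, b, c, d, e, f], ?_, fun i j => ?_⟩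
  · rw [Fin.strictMono_iff_lt_succ]
    intro i
    fin_cases i <;> assumption
  · simp only [p351624, Equiv.ofBijective_apply]
    fin_cases i <;> fin_cases j <;> simp <;> order

variable {k n : ℕ} {ρ : Equiv.Perm (Fin k)}

theorem Contains.symm {π : Equiv.Perm (Fin n)} (h : Contains ρ π) :
    Contains ρ.symm π.symm := by
  obtain ⟨f, hf, H⟩ := h
  refine ⟨fun i => π (f (ρ.symm i)), fun i j hij => ?_, fun i j => ?_⟩
  · rw [← H]
    simpa using hij
  · simp [hf.lt_iff_lt]

theorem InA.symm {π : Equiv.Perm (Fin n)} (h : InA π) : InA π.symm := by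
  have key : ∀ {k : ℕ} {ρ : Equiv.Perm (Fin k)}, (∀ i, ρ (ρ i) = i) → Avoids ρ π →
      Avoids ρ π.symm := by
    intro k ρ hρ hav hc
    apply hav
    have := hc.symm
    have hsymm : ρ.symm = ρ := Equiv.ext fun i => by rw [Equiv.symm_apply_eq, hρ]
    rwa [hsymm, Equiv.symm_symm] at this
  refine ⟨key ?_ h.1, key ?_ h.2.1, key ?_ h.2.2.1, key ?_ h.2.2.2⟩
  · simp only [p4231, Equiv.ofBijective_apply]
    decide
  · simp only [p35142, Equiv.ofBijective_apply]
    decide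
  · simp only [p42513, Equiv.ofBijective_apply]
    decide
  · simp only [p351624, Equiv.ofBijective_apply]
    decide

theorem Contains.insertPoint {σ : Equiv.Perm (Fin n)} (h : Contains ρ σ) (p v : Fin (n + 1)) :
    Contains ρ (insertPoint p v σ) := by
  obtain ⟨f, hf, H⟩ := h
  refine ⟨fun i => p.succAbove (f i), fun i j hij => ?_, fun i j => ?_⟩
  · exact (Fin.strictMono_succAbove p) (hf hij)
  · simp only [insertPoint_succAbove, (Fin.strictMono_succAbove v).lt_iff_lt, H]

theorem InA.of_insertPoint {σ : Equiv.Perm (Fin n)} {p v : Fin (n + 1)}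
    (h : InA (insertPoint p v σ)) : InA σ :=
  ⟨fun hc => h.1 (hc.insertPoint p v), fun hc => h.2.1 (hc.insertPoint p v),
    fun hc => h.2.2.1 (hc.insertPoint p v), fun hc => h.2.2.2 (hc.insertPoint p v)⟩

/-- An occurrence of a pattern that does not use the inserted point is an occurrence in the
original permutation. -/
theorem contains_of_forall_ne {σ : Equiv.Perm (Fin n)} {p v : Fin (n + 1)}
    {f : Fin k → Fin (n + 1)} (hf : StrictMono f)
    (H : ∀ i j, ρ i < ρ j ↔ insertPoint p v σ (f i) < insertPoint p v σ (f j))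
    (hp : ∀ i, f i ≠ p) : Contains ρ σ := by
  choose g hg using fun i => Fin.exists_succAbove_eq (hp i)
  refine ⟨g, fun i j hij => ?_, fun i j => ?_⟩
  · have := hf hij
    rwa [← hg i, ← hg j, (Fin.strictMono_succAbove p).lt_iff_lt] at this
  · rw [H, ← hg i, ← hg j, insertPoint_succAbove, insertPoint_succAbove,
      (Fin.strictMono_succAbove v).lt_iff_lt]

/-- The first entry of `ρ` exceeds at least two other entries. -/
def FirstNotLow (ρ : Equiv.Perm (Fin k)) : Prop :=
  ∀ z : Fin k, (z : ℕ) = 0 → ∃ a b, a ≠ b ∧ ρ a < ρ z ∧ ρ b < ρ z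

/-- No two neighbouring entries of `ρ` are its two smallest entries. -/
def LowestNotAdjacent (ρ : Equiv.Perm (Fin k)) : Prop :=
  ∀ i j : Fin k, (i : ℕ) + 1 = j ∨ (j : ℕ) + 1 = i →
    ∃ l, l ≠ i ∧ l ≠ j ∧ (ρ l < ρ i ∨ ρ l < ρ j)

theorem FirstNotLow.ne_zero (hρ : FirstNotLow ρ) {π : Equiv.Perm (Fin (n + 1))}
    (h0 : (π 0 : ℕ) = 1) {f : Fin k → Fin (n + 1)} (hf : StrictMono f)
    (H : ∀ i j, ρ i < ρ j ↔ π (f i) < π (f j)) (i : Fin k) : f i ≠ 0 := by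
  intro hi
  have hi0 : (i : ℕ) = 0 := by
    by_contra hne
    have hlt : (⟨0, by omega⟩ : Fin k) < i := by
      rw [Fin.lt_def]
      simp only
      omega
    have := hf hlt
    rw [hi] at this
    exact absurd this (Fin.not_lt_zero _)
  obtain ⟨a, b, hab, ha, hb⟩ := hρ i hi0
  rw [H, hi, Fin.lt_def, h0] at ha hb
  exact hab (hf.injective (eq_of_apply_val π (by omega)))

theorem avoids_insertPoint_zero (hρ : FirstNotLow ρ) {σ : Equiv.Perm (Fin n)} {v : Fin (n + 1)}
    (hv : (v : ℕ) = 1) (h : Avoids ρ σ) : Avoids ρ (insertPoint 0 v σ) := by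
  rintro ⟨f, hf, H⟩
  exact h (contains_of_forall_ne hf H (hρ.ne_zero (by rw [insertPoint_self, hv]) hf H))

theorem avoids_insertPoint_adjacent (hρ : FirstNotLow ρ) (hρ' : LowestNotAdjacent ρ)
    {σ : Equiv.Perm (Fin (n + 1))} (h0 : (σ 0 : ℕ) = 1) {p v : Fin (n + 2)} (hv : (v : ℕ) = 2)
    {m : Fin (n + 1)} (hm : (σ m : ℕ) = 0) (hp : (p : ℕ) = m ∨ (p : ℕ) = m + 1)
    (h : Avoids ρ σ) : Avoids ρ (insertPoint p v σ) := by
  have hm0 : 0 < (m : ℕ) := by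
    rcases Nat.eq_zero_or_pos (m : ℕ) with hz | hz
    · have : m = 0 := Fin.ext hz
      subst this
      omega
    · exact hz
  have h0' : (insertPoint p v σ 0 : ℕ) = 1 := by
    have : (0 : Fin (n + 2)) = p.succAbove 0 := by
      apply Fin.ext
      have hp0 : ((0 : Fin (n + 1)) : ℕ) < p := by
        rw [Fin.val_zero]
        omega
      rw [val_succAbove, if_pos hp0]
      rfl
    rw [this, insertPoint_succAbove, val_succAbove]
    simp [h0, hv]
  have hm' : (insertPoint p v σ (p.succAbove m) : ℕ) = 0 := by
    rw [insertPoint_succAbove, val_succAbove]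
    simp [hm, hv]
  have hmp : (p.succAbove m : ℕ) + 1 = p ∨ (p.succAbove m : ℕ) = p + 1 := by
    rw [val_succAbove]
    split_ifs <;> omega
  rintro ⟨f, hf, H⟩
  have hne0 := hρ.ne_zero h0' hf H
  by_cases hpf : ∃ i, f i = p
  swap
  · exact h (contains_of_forall_ne hf H fun i hi => hpf ⟨i, hi⟩)
  obtain ⟨i, hi⟩ := hpf
  have hlarge : ∀ j, f j ≠ p → f j ≠ p.succAbove m → 2 < (insertPoint p v σ (f j) : ℕ) := by
    intro j h1 h2
    have e0 : (insertPoint p v σ (f j) : ℕ) ≠ 1 := fun h =>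
      hne0 j (eq_of_apply_val _ (h.trans h0'.symm))
    have e1 : (insertPoint p v σ (f j) : ℕ) ≠ 0 := fun h =>
      h2 (eq_of_apply_val _ (h.trans hm'.symm))
    have e2 : (insertPoint p v σ (f j) : ℕ) ≠ 2 := fun h =>
      h1 (eq_of_apply_val (insertPoint p v σ) (by rw [h, insertPoint_self, hv]))
    omega
  have hpv : (insertPoint p v σ p : ℕ) = 2 := by rw [insertPoint_self, hv]
  by_cases hmf : ∃ j, f j = p.succAbove m
  · obtain ⟨j, hj⟩ := hmf
    have hadj : (i : ℕ) + 1 = j ∨ (j : ℕ) + 1 = i := by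
      by_contra hcon
      have hijne : (i : ℕ) ≠ j := by
        intro hij
        have : i = j := Fin.ext hij
        subst this
        exact Fin.succAbove_ne p m (hj.symm.trans hi)
      rcases lt_or_gt_of_ne hijne with hlt | hlt
      · have h1 : i < ⟨i + 1, by omega⟩ := by rw [Fin.lt_def]; simp
        have h2 : (⟨i + 1, by omega⟩ : Fin k) < j := by rw [Fin.lt_def]; simp only; omega
        have h3 := hf h1
        have h4 := hf h2
        rw [Fin.lt_def] at h3 h4
        rw [hi] at h3
        rw [hj] at h4
        omega
      · have h1 : j < ⟨j + 1, by omega⟩ := by rw [Fin.lt_def]; simp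
        have h2 : (⟨j + 1, by omega⟩ : Fin k) < i := by rw [Fin.lt_def]; simp only; omega
        have h3 := hf h1
        have h4 := hf h2
        rw [Fin.lt_def] at h3 h4
        rw [hj] at h3
        rw [hi] at h4
        omega
    obtain ⟨l, hli, hlj, hl⟩ := hρ' i j hadj
    have h1 := hlarge l (fun h => hli (hf.injective (h.trans hi.symm)))
      (fun h => hlj (hf.injective (h.trans hj.symm)))
    rw [H, H, hi, hj, Fin.lt_def, Fin.lt_def] at hl
    omega
  · have hval : ∀ j, j ≠ i → f j ≠ p ∧ f j ≠ p.succAbove m := fun j hj =>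
      ⟨fun h => hj (hf.injective (h.trans hi.symm)), fun h => hmf ⟨j, h⟩⟩
    have hval' : ∀ j, j ≠ i → (f j : ℕ) ≠ p ∧ (f j : ℕ) ≠ p.succAbove m := fun j hj =>
      ⟨fun h => (hval j hj).1 (Fin.ext h), fun h => (hval j hj).2 (Fin.ext h)⟩
    refine h (contains_of_forall_ne (p := p) (v := v)
      (f := Function.update f i (p.succAbove m)) (fun a b hab => ?_) (fun a b => ?_) fun a => ?_)
    · have h1 := hf hab
      rw [Fin.lt_def] at h1
      rcases eq_or_ne i a with rfl | ha <;> rcases eq_or_ne i b with rfl | hb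
      · exact absurd hab (lt_irrefl _)
      · have := hval' b hb.symm
        rw [Function.update_self, Function.update_of_ne hb.symm, Fin.lt_def]
        rw [hi] at h1
        omega
      · have := hval' a ha.symm
        rw [Function.update_self, Function.update_of_ne ha.symm, Fin.lt_def]
        rw [hi] at h1
        omega
      · rwa [Function.update_of_ne ha.symm, Function.update_of_ne hb.symm]
    · rw [H]
      rcases eq_or_ne i a with rfl | ha <;> rcases eq_or_ne i b with rfl | hb
      · simp
      · have := hlarge b (hval b hb.symm).1 (hval b hb.symm).2
        rw [Function.update_self, Function.update_of_ne hb.symm, Fin.lt_def, Fin.lt_def, hi]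
        omega
      · have := hlarge a (hval a ha.symm).1 (hval a ha.symm).2
        rw [Function.update_self, Function.update_of_ne ha.symm, Fin.lt_def, Fin.lt_def, hi]
        omega
      · rw [Function.update_of_ne ha.symm, Function.update_of_ne hb.symm]
    · rcases eq_or_ne i a with rfl | ha
      · rw [Function.update_self]
        exact Fin.succAbove_ne p m
      · rw [Function.update_of_ne ha.symm]
        exact (hval a ha.symm).1

theorem basis_properties :
    (FirstNotLow p4231 ∧ LowestNotAdjacent p4231) ∧
    (FirstNotLow p35142 ∧ LowestNotAdjacent p35142) ∧
    (FirstNotLow p42513 ∧ LowestNotAdjacent p42513) ∧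
    (FirstNotLow p351624 ∧ LowestNotAdjacent p351624) := by
  simp only [FirstNotLow, LowestNotAdjacent, p4231, p35142, p42513, p351624,
    Equiv.ofBijective_apply]
  refine ⟨⟨?_, ?_⟩, ⟨?_, ?_⟩, ⟨?_, ?_⟩, ⟨?_, ?_⟩⟩ <;> decide

theorem InA.insertPoint_zero {σ : Equiv.Perm (Fin n)} {v : Fin (n + 1)}
    (hv : (v : ℕ) = 1) (h : InA σ) : InA (insertPoint 0 v σ) :=
  have hb := basis_properties
  ⟨avoids_insertPoint_zero hb.1.1 hv h.1, avoids_insertPoint_zero hb.2.1.1 hv h.2.1,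
    avoids_insertPoint_zero hb.2.2.1.1 hv h.2.2.1, avoids_insertPoint_zero hb.2.2.2.1 hv h.2.2.2⟩

theorem InA.insertPoint_adjacent {σ : Equiv.Perm (Fin (n + 1))} (h0 : (σ 0 : ℕ) = 1)
    {p v : Fin (n + 2)} (hv : (v : ℕ) = 2) {m : Fin (n + 1)} (hm : (σ m : ℕ) = 0)
    (hp : (p : ℕ) = m ∨ (p : ℕ) = m + 1) (h : InA σ) : InA (insertPoint p v σ) :=
  have hb := basis_properties
  ⟨avoids_insertPoint_adjacent hb.1.1 hb.1.2 h0 hv hm hp h.1,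
    avoids_insertPoint_adjacent hb.2.1.1 hb.2.1.2 h0 hv hm hp h.2.1,
    avoids_insertPoint_adjacent hb.2.2.1.1 hb.2.2.1.2 h0 hv hm hp h.2.2.1,
    avoids_insertPoint_adjacent hb.2.2.2.1 hb.2.2.2.2 h0 hv hm hp h.2.2.2⟩

end Patterns

section Corner

variable {n : ℕ} {π : Equiv.Perm (Fin (n + 3))}

theorem IsSimple.apply_zero_ne_zero (h : IsSimple π) : (π 0 : ℕ) ≠ 0 := by
  intro h0
  have key := h.bounds (a := 1) (b := n + 2) (c := 1) (d := n + 2) (by omega) (by omega)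
    (fun i => by
      have h1 := i.2
      have h2 := (π i).2
      have h3 : (i : ℕ) = 0 ↔ (π i : ℕ) = 0 := by
        constructor
        · intro hi
          have : i = 0 := Fin.ext hi
          rw [this, h0]
        · intro hi
          have : i = 0 := eq_of_apply_val π (hi.trans h0.symm)
          rw [this, Fin.val_zero]
      omega)
  omega

/-- Two neighbours in a simple permutation do not have neighbouring values. -/
theorem IsSimple.not_adjacent (h : IsSimple π) {i j : Fin (n + 3)} (hij : (i : ℕ) + 1 = j)
    (hv : (π i : ℕ) + 1 = π j ∨ (π j : ℕ) + 1 = π i) : False := by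
  have key := h.bounds (a := i) (b := j) (c := min (π i : ℕ) (π j)) (d := max (π i : ℕ) (π j))
    (by omega) j.2
    (fun l => by
      have hi : (l : ℕ) = i ↔ (π l : ℕ) = π i :=
        ⟨fun e => by rw [Fin.ext e], fun e => by rw [eq_of_apply_val π e]⟩
      have hj : (l : ℕ) = j ↔ (π l : ℕ) = π j :=
        ⟨fun e => by rw [Fin.ext e], fun e => by rw [eq_of_apply_val π e]⟩
      omega)
  have := j.2
  omega

/-- The first entries of a simple permutation, if they are bounded below by the very first one,
are separated in value by some later entry. -/
theorem IsSimple.exists_value_separator (h : IsSimple π) {t : ℕ} (ht : 2 ≤ t) (htn : t < n + 3)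
    (hup : ∀ i : Fin (n + 3), 0 < (i : ℕ) → (i : ℕ) < t → (π 0 : ℕ) < π i) :
    ∃ y w : Fin (n + 3), 0 < (y : ℕ) ∧ (y : ℕ) < t ∧ t ≤ (w : ℕ) ∧
      (π 0 : ℕ) < π w ∧ (π w : ℕ) < π y := by
  by_contra! hcon
  have key := h.forall_mem (fun i => (i : ℕ) < t)
    (fun a b j _ hb _ h2 => lt_of_le_of_lt h2 hb)
    (fun a b j ha hb h1 h2 => by
      rw [Fin.le_def] at h1 h2
      by_contra hj
      have hval : ∀ {i : Fin (n + 3)}, (i : ℕ) = 0 → (π i : ℕ) = π 0 := fun {i} e => by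
        rw [show i = 0 from Fin.ext e]
      have hja : (π j : ℕ) ≠ π 0 := fun e => by
        have : j = 0 := eq_of_apply_val π e
        rw [this, Fin.val_zero] at hj
        omega
      have hjb : (π j : ℕ) ≠ π b := fun e => by
        have : j = b := eq_of_apply_val π e
        rw [this] at hj
        omega
      have h0j : (π 0 : ℕ) < π j := by
        rcases Nat.eq_zero_or_pos (a : ℕ) with e | e
        · have := hval e
          omega
        · have := hup a e ha
          omega
      rcases Nat.eq_zero_or_pos (b : ℕ) with e | e
      · have := hval e
        omega
      · have := hcon b j e hb (by omega) h0j
        omega)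
    (a := 0) (b := 1) (by simp only [Fin.val_zero]; omega) (by simp only [Fin.val_one]; omega)
    (by simp) ⟨t, htn⟩
  simp at key

/-- The smallest entries of a simple permutation, if they do not precede the least one, are
separated in position by some larger entry. -/
theorem IsSimple.exists_position_separator (h : IsSimple π) {k : Fin (n + 3)}
    (hk : (π k : ℕ) = 0) {t : ℕ} (ht : 2 ≤ t) (htn : t < n + 3)
    (hup : ∀ i : Fin (n + 3), 0 < (π i : ℕ) → (π i : ℕ) < t → (k : ℕ) < i) :
    ∃ z w : Fin (n + 3), 0 < (π z : ℕ) ∧ (π z : ℕ) < t ∧ t ≤ (π w : ℕ) ∧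
      (k : ℕ) < w ∧ (w : ℕ) < z := by
  have hk' : π.symm 0 = k := by
    rw [Equiv.symm_apply_eq]
    exact (Fin.ext hk).symm
  obtain ⟨y, w, h1, h2, h3, h4, h5⟩ := h.symm.exists_value_separator ht htn (fun i h1 h2 => by
    rw [hk']
    exact hup (π.symm i) (by simpa using h1) (by simpa using h2))
  rw [hk'] at h4
  exact ⟨π.symm y, π.symm w, by simpa using h1, by simpa using h2, by simpa using h3, h4, h5⟩

/-- A simple permutation in the class starts with its second smallest entry or has its least
entry in second position. -/
theorem apply_zero_eq_one_or_apply_one_eq_zero (hs : IsSimple π) (hA : InA π) :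
    (π 0 : ℕ) = 1 ∨ (π 1 : ℕ) = 0 := by
  by_contra! hcon
  obtain ⟨hv1, hk1⟩ := hcon
  have hv0 := hs.apply_zero_ne_zero
  obtain ⟨k, hk⟩ := exists_apply_val π (v := 0) (by omega)
  have ne_val : ∀ {i j : Fin (n + 3)}, (i : ℕ) ≠ j → (π i : ℕ) ≠ π j := fun hij e =>
    hij (by rw [eq_of_apply_val π e])
  have eq_zero : ∀ {i : Fin (n + 3)}, (i : ℕ) = 0 → (π i : ℕ) = π 0 := fun {i} e => by
    rw [show i = 0 from Fin.ext e]
  have hk0 : (k : ℕ) ≠ 0 := fun e => hv0 ((eq_zero e).symm.trans hk)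
  have hk2 : (k : ℕ) ≠ 1 := fun e => hk1 (by rw [← hk, show k = 1 from Fin.ext e])
  have hkn := k.2
  have hvn := (π 0).2
  have z0 : ((0 : Fin (n + 3)) : ℕ) = 0 := Fin.val_zero _
  have av4 : ∀ a b c d : Fin (n + 3), (a : ℕ) < b → (b : ℕ) < c → (c : ℕ) < d →
      (π d : ℕ) < π b → (π b : ℕ) < π c → (π c : ℕ) < π a → False :=
    fun a b c d => hA.not_4231
  have av42513 : ∀ a b c d e : Fin (n + 3), (a : ℕ) < b → (b : ℕ) < c → (c : ℕ) < d →
      (d : ℕ) < e → (π d : ℕ) < π b → (π b : ℕ) < π e → (π e : ℕ) < π a → (π a : ℕ) < π c →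
      False :=
    fun a b c d e => hA.not_42513
  -- separators of both kinds above and to the right of the two corner points cannot coexist
  have final : ∀ y w z w' : Fin (n + 3), 0 < (y : ℕ) → (y : ℕ) < k → (k : ℕ) < w →
      (π 0 : ℕ) < π w → (π w : ℕ) < π y → 0 < (π z : ℕ) → (π z : ℕ) < π 0 → (k : ℕ) < w' →
      (w' : ℕ) < z → (π 0 : ℕ) < π w' → False := by
    intro y w z w' h1 h2 h3 h4 h5 h6 h7 h8 h9 h10
    have av35142 : ∀ e : Fin (n + 3), (k : ℕ) < e → (e : ℕ) < z → (π 0 : ℕ) < π e →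
        (π e : ℕ) < π y → False := fun e e1 e2 e3 e4 =>
      hA.not_35142 (a := 0) (b := y) (c := k) (d := e) (e := z) h1 h2 e1 e2
        (hk ▸ h6 : (π k : ℕ) < π z) h7 e3 e4
    have hwz : (z : ℕ) < w := by
      by_contra hle
      have : (w : ℕ) ≠ z := fun e => by
        rw [show w = z from Fin.ext e] at h4
        omega
      exact av35142 w h3 (by omega) h4 h5
    have hw'y : (π y : ℕ) < π w' := by
      by_contra hle
      have := ne_val (i := y) (j := w') (by omega)
      exact av35142 w' h8 h9 h10 (by omega)
    exact hA.not_351624 (a := 0) (b := y) (c := k) (d := w') (e := z) (f := w) h1 h2 h8 h9 hwz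
      (hk ▸ h6 : (π k : ℕ) < π z) h7 h4 h5 hw'y
  by_cases hQ : ∃ x : Fin (n + 3), 0 < (x : ℕ) ∧ (x : ℕ) < k ∧ (π x : ℕ) < π 0
  swap
  · push Not at hQ
    have hQ' : ∀ i : Fin (n + 3), 0 < (i : ℕ) → (i : ℕ) < k → (π 0 : ℕ) < π i := fun i h1 h2 => by
      have := hQ i h1 h2
      have := ne_val (i := i) (j := 0) (by omega)
      omega
    obtain ⟨y, w, h1, h2, h3, h4, h5⟩ :=
      hs.exists_value_separator (t := k) (by omega) hkn hQ'
    obtain ⟨z, w', g1, g2, g3, g4, g5⟩ :=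
      hs.exists_position_separator hk (t := π 0) (by omega) hvn (fun i h1 h2 => by
        have i0 : (i : ℕ) ≠ 0 := fun e => by
          have := eq_zero e
          omega
        have ik : (i : ℕ) ≠ k := fun e => by
          rw [show i = k from Fin.ext e] at h1
          omega
        by_contra hle
        have := hQ' i (by omega) (by omega)
        omega)
    have hwk : (w : ℕ) ≠ k := fun e => by
      rw [show w = k from Fin.ext e] at h4
      omega
    have := ne_val (i := w') (j := 0) (by omega)
    exact final y w z w' h1 h2 (by omega) h4 h5 g1 g2 g4 g5 (by omega)
  · have hdec : ∀ i j : Fin (n + 3), 0 < (i : ℕ) → (i : ℕ) < j → (j : ℕ) < k →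
        (π j : ℕ) < π 0 → (π j : ℕ) < π i := by
      intro i j h1 h2 h3 h4
      by_contra hle
      have e1 := ne_val (i := i) (j := j) (by omega)
      have e2 := ne_val (i := i) (j := k) (by omega)
      exact av4 0 i j k h1 h2 h3 (by omega) (by omega) h4
    obtain ⟨x₀, hx₀⟩ := hQ
    classical
    set Q := Finset.univ.filter fun x : Fin (n + 3) =>
      0 < (x : ℕ) ∧ (x : ℕ) < k ∧ (π x : ℕ) < π 0 with hQdef
    have hQmem : ∀ x, x ∈ Q ↔ 0 < (x : ℕ) ∧ (x : ℕ) < k ∧ (π x : ℕ) < π 0 := by simp [hQdef]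
    have hQne : Q.Nonempty := ⟨x₀, (hQmem _).2 hx₀⟩
    obtain ⟨x, hxQ, hxmin⟩ := Q.exists_min_image (fun i => (i : ℕ)) hQne
    obtain ⟨r, hrQ, hrmax⟩ := Q.exists_max_image (fun i => (i : ℕ)) hQne
    have hxr := hxmin r hrQ
    obtain ⟨hx1, hx2, hx3⟩ := (hQmem _).1 hxQ
    obtain ⟨hr1, hr2, hr3⟩ := (hQmem _).1 hrQ
    simp only [hQmem] at hxmin hrmax
    have hxrv : (π r : ℕ) ≤ π x := by
      rcases eq_or_lt_of_le hxr with e | e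
      · rw [show x = r from Fin.ext e]
      · exact (hdec x r hx1 e hr2 hr3).le
    have hrk := ne_val (i := r) (j := k) (by omega)
    have hxtop : ∀ i : Fin (n + 3), 0 < (i : ℕ) → (i : ℕ) < k → (π i : ℕ) < π 0 →
        (π i : ℕ) ≤ π x := fun i h1 h2 h3 => by
      rcases eq_or_lt_of_le (hxmin i ⟨h1, h2, h3⟩) with e | e
      · rw [show x = i from Fin.ext e]
      · exact (hdec x i hx1 e h2 h3).le
    have hrbot : ∀ i : Fin (n + 3), 0 < (i : ℕ) → (i : ℕ) < k → (π i : ℕ) < π 0 →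
        (π r : ℕ) ≤ π i := fun i h1 h2 h3 => by
      rcases eq_or_lt_of_le (hrmax i ⟨h1, h2, h3⟩) with e | e
      · rw [show i = r from Fin.ext e]
      · exact (hdec i r h1 e hr2 hr3).le
    have hleft : (∃ y w : Fin (n + 3), 0 < (y : ℕ) ∧ (y : ℕ) < x ∧ (k : ℕ) < w ∧
        (π 0 : ℕ) < π w ∧ (π w : ℕ) < π y) ∨
        ∃ z : Fin (n + 3), (k : ℕ) < z ∧ (π x : ℕ) < π z ∧ (π z : ℕ) < π 0 := by
      rcases Nat.lt_or_ge 1 (x : ℕ) with hx | hx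
      · left
        obtain ⟨y, w, h1, h2, h3, h4, h5⟩ :=
          hs.exists_value_separator (t := x) hx x.2 (fun i h1 h2 => by
            by_contra hle
            have := ne_val (i := i) (j := 0) (by omega)
            have := hxmin i ⟨h1, by omega, by omega⟩
            omega)
        refine ⟨y, w, h1, h2, ?_, h4, h5⟩
        by_contra hle
        have e1 : (w : ℕ) ≠ x := fun e => by
          rw [show w = x from Fin.ext e] at h4
          omega
        have e2 : (w : ℕ) ≠ k := fun e => by
          rw [show w = k from Fin.ext e] at h4
          omega
        exact av4 y x w k (by omega) (by omega) (by omega) (by omega) (by omega) h5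
      · right
        have hadj : (π x : ℕ) + 1 ≠ π 0 := fun e =>
          hs.not_adjacent (i := 0) (j := x) (by omega) (Or.inr e)
        obtain ⟨z, hz⟩ := exists_apply_val π (v := π 0 - 1) (by omega)
        refine ⟨z, ?_, by omega, by omega⟩
        have e0 : (z : ℕ) ≠ 0 := fun e => by
          have := eq_zero e
          omega
        have e1 : (z : ℕ) ≠ k := fun e => by
          rw [show z = k from Fin.ext e] at hz
          omega
        by_contra hle
        have := hxtop z (by omega) (by omega) (by omega)
        omega
    have hright : (∃ z w : Fin (n + 3), 0 < (π z : ℕ) ∧ (π z : ℕ) < π r ∧ (k : ℕ) < w ∧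
        (w : ℕ) < z ∧ (π 0 : ℕ) < π w) ∨
        ∃ y : Fin (n + 3), (r : ℕ) < y ∧ (y : ℕ) < k ∧ (π 0 : ℕ) < π y := by
      rcases Nat.lt_or_ge 1 (π r : ℕ) with hr | hr
      · left
        obtain ⟨z, w, h1, h2, h3, h4, h5⟩ :=
          hs.exists_position_separator hk (t := π r) hr (π r).2 (fun i h1 h2 => by
            have i0 : (i : ℕ) ≠ 0 := fun e => by
              have := eq_zero e
              omega
            have ik : (i : ℕ) ≠ k := fun e => by
              rw [show i = k from Fin.ext e] at h1
              omega
            by_contra hle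
            have := hrbot i (by omega) (by omega) (by omega)
            omega)
        refine ⟨z, w, h1, h2, h4, h5, ?_⟩
        by_contra hle
        have e1 := ne_val (i := w) (j := 0) (by omega)
        have e2 := ne_val (i := w) (j := r) (by omega)
        exact av4 0 r w z hr1 (by omega) h5 h2 (by omega) (by omega)
      · right
        have hadj : (r : ℕ) + 1 ≠ k := fun e =>
          hs.not_adjacent (i := r) (j := k) e (Or.inr (by omega))
        obtain ⟨y, hy⟩ : ∃ y : Fin (n + 3), (y : ℕ) = k - 1 := ⟨⟨k - 1, by omega⟩, rfl⟩
        refine ⟨y, by omega, by omega, ?_⟩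
        by_contra hle
        have e1 := ne_val (i := y) (j := 0) (by omega)
        have := hrmax y ⟨by omega, by omega, by omega⟩
        omega
    rcases hleft with ⟨y, w, h1, h2, h3, h4, h5⟩ | ⟨z, h1, h2, h3⟩ <;>
      rcases hright with ⟨z', w', g1, g2, g3, g4, g5⟩ | ⟨y', g1, g2, g3⟩
    · exact final y w z' w' h1 (by omega) h3 h4 h5 g1 (by omega) g3 g4 g5
    · have hyy := ne_val (i := y) (j := y') (by omega)
      rcases Nat.lt_or_ge (π y' : ℕ) (π y) with hlt | hge
      · exact av4 y r y' k (by omega) g1 g2 (by omega) (by omega) hlt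
      · exact av42513 y r y' k w (by omega) g1 g2 h3 (by omega) (by omega) h5 (by omega)
    · rcases Nat.lt_trichotomy (z : ℕ) z' with hlt | heq | hgt
      · exact av4 0 x z z' hx1 (by omega) hlt (by omega) h2 h3
      · rw [show z = z' from Fin.ext heq] at h2
        omega
      · exact av42513 0 x w' z' z hx1 (by omega) g4 hgt (by omega) h2 h3 g5
    · exact av42513 0 r y' k z hr1 g1 g2 h1 (by omega) (by omega) h3 g3

end Corner

section Counting

/-- The simple permutations of length `N` in the class that start with their second smallest
entry. -/
def startSet (N : ℕ) : Set (Equiv.Perm (Fin N)) :=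
  {π | IsSimple π ∧ InA π ∧ ∀ i : Fin N, (i : ℕ) = 0 → (π i : ℕ) = 1}

/-- The members of `startSet N` whose third smallest entry is immediately to the left (`c = 0`)
or immediately to the right (`c = 1`) of the least entry. -/
def adjSet (c N : ℕ) : Set (Equiv.Perm (Fin N)) :=
  {π | π ∈ startSet N ∧ ∃ k q : Fin N, (π k : ℕ) = 0 ∧ (π q : ℕ) = 2 ∧ (q : ℕ) + 1 = k + 2 * c}

variable {n : ℕ}

/-- Deleting the first entry, if it is the second smallest one, preserves simplicity unless the
least and the third smallest entries are neighbours. -/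
theorem isSimple_of_insertPoint_zero {σ : Equiv.Perm (Fin (n + 3))} {v : Fin (n + 3 + 1)}
    (hv : (v : ℕ) = 1) (hs : IsSimple (insertPoint 0 v σ)) (hA : InA (insertPoint 0 v σ))
    (hadj : ∀ k q : Fin (n + 3), (σ k : ℕ) = 0 → (σ q : ℕ) = 1 →
      (q : ℕ) + 1 ≠ k ∧ (q : ℕ) ≠ k + 1) : IsSimple σ := by
  refine isSimple_of_bounds fun a b c d hab hb hcd H => ?_
  have hpos : ∀ i : Fin (n + 3), ((0 : Fin (n + 3 + 1)).succAbove i : ℕ) = i + 1 := fun i => by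
    rw [val_succAbove, if_neg (by simp)]
  have hval : ∀ i : Fin (n + 3), (insertPoint 0 v σ ((0 : Fin (n + 3 + 1)).succAbove i) : ℕ) =
      if (σ i : ℕ) < 1 then (σ i : ℕ) else σ i + 1 := fun i => by
    rw [insertPoint_succAbove, val_succAbove, hv]
  rcases Nat.eq_zero_or_pos c with hc | hc
  swap
  · have := hs.bounds (a := a + 1) (b := b + 1) (c := c + 1) (d := d + 1) (by omega) (by omega)
      ((Fin.forall_iff_succAbove 0).2 ⟨by rw [insertPoint_self, hv, Fin.val_zero]; omega,
        fun i => by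
          have := H i
          rw [hpos, hval]
          split_ifs <;> omega⟩)
    omega
  rcases Nat.eq_zero_or_pos a with ha | ha
  · have := hs.bounds (a := 0) (b := b + 1) (c := 0) (d := d + 1) (by omega) (by omega)
      ((Fin.forall_iff_succAbove 0).2 ⟨by rw [insertPoint_self, hv, Fin.val_zero]; omega,
        fun i => by
          have := H i
          rw [hpos, hval]
          split_ifs <;> omega⟩)
    omega
  exfalso
  obtain ⟨k, hk⟩ := exists_apply_val σ (v := 0) (by omega)
  obtain ⟨q, hq⟩ := exists_apply_val σ (v := 1) (by omega)
  have hkq := hadj k q hk hq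
  have Hk := H k
  have Hq := H q
  have H0 := H 0
  rw [Fin.val_zero] at H0
  have hσ := hA.of_insertPoint
  have av4 : ∀ x y z : Fin (n + 3), 0 < (x : ℕ) → (x : ℕ) < y → (y : ℕ) < z →
      (σ z : ℕ) < σ x → (σ x : ℕ) < σ y → (σ y : ℕ) < σ 0 → False :=
    fun x y z => hσ.not_4231 (a := 0)
  have ne_val : ∀ {i j : Fin (n + 3)}, (i : ℕ) ≠ j → (σ i : ℕ) ≠ σ j := fun hij e =>
    hij (by rw [eq_of_apply_val σ e])
  have hkq' : (k : ℕ) ≠ q := fun e => by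
    rw [Fin.ext e] at hk
    omega
  rcases lt_or_gt_of_ne hkq' with hlt | hlt
  swap
  · obtain ⟨x, hx⟩ : ∃ x : Fin (n + 3), (x : ℕ) = q + 1 := ⟨⟨q + 1, by omega⟩, rfl⟩
    have e1 := ne_val (i := x) (j := k) (by omega)
    have e2 := ne_val (i := x) (j := q) (by omega)
    have e3 := H x
    exact av4 q x k (by omega) (by omega) (by omega) (by omega) (by omega) (by omega)
  obtain ⟨x, hx⟩ : ∃ x : Fin (n + 3), (x : ℕ) + 1 = q :=
    ⟨⟨q - 1, by omega⟩, by simp only; omega⟩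
  have e1 := ne_val (i := x) (j := k) (by omega)
  have e2 := ne_val (i := x) (j := q) (by omega)
  have Hx := H x
  have key := hs.forall_mem
    (fun y => (x : ℕ) + 1 ≤ y ∧ (insertPoint 0 v σ y : ℕ) ≤ σ x + 1)
    (fun y z j hy hz h1 h2 => by
      rw [Fin.le_def] at h1 h2
      refine ⟨by omega, ?_⟩
      obtain rfl | ⟨i, rfl⟩ := Fin.eq_self_or_eq_succAbove 0 j
      · rw [Fin.val_zero] at h1
        omega
      obtain rfl | ⟨i', rfl⟩ := Fin.eq_self_or_eq_succAbove 0 z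
      · rw [Fin.val_zero] at h2
        omega
      rw [hpos] at h1 h2 hz
      rw [hpos] at h2
      rw [hval] at hz ⊢
      by_contra hcon
      have hi : (i : ℕ) ≠ i' := fun e => by
        rw [Fin.ext e] at hcon
        exact hcon hz.2
      have hxi : (i : ℕ) ≠ x := fun e => by
        rw [show i = x from Fin.ext e] at hcon
        split_ifs at hcon <;> omega
      have f1 := ne_val (i := i') (j := x) (by omega)
      have f2 := H i
      have f3 := H i'
      split_ifs at hcon hz <;>
        exact av4 x i i' (by omega) (by omega) (by omega) (by omega) (by omega) (by omega))
    (fun y z j hy hz h1 h2 => by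
      rw [Fin.le_def] at h1 h2
      refine ⟨?_, by omega⟩
      obtain rfl | ⟨i', rfl⟩ := Fin.eq_self_or_eq_succAbove 0 y
      · have := hy.1
        rw [Fin.val_zero] at this
        omega
      rw [hpos] at hy
      have f1 := ne_val (i := i') (j := k) (by omega)
      rw [hval, if_neg (by omega)] at h1
      obtain rfl | ⟨i, rfl⟩ := Fin.eq_self_or_eq_succAbove 0 j
      · rw [insertPoint_self] at h1
        omega
      rw [hpos]
      by_contra hcon
      have f2 := ne_val (i := i) (j := q) (by omega)
      have f3 := ne_val (i := i) (j := x) (by omega)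
      rw [hval] at h1 h2
      have hi0 : (i : ℕ) ≠ 0 := fun e => by
        rw [show i = 0 from Fin.ext e] at h2
        split_ifs at h2 <;> omega
      split_ifs at h1 h2 <;>
        exact av4 i x q (by omega) (by omega) (by omega) (by omega) (by omega) (by omega))
    (a := (0 : Fin (n + 3 + 1)).succAbove x) (b := (0 : Fin (n + 3 + 1)).succAbove q)
    (by rw [hpos, hval]; split_ifs <;> omega)
    (by rw [hpos, hval]; split_ifs <;> omega)
    (fun e => by
      have := congrArg Fin.val e
      rw [hpos, hpos] at this
      omega) 0
  rw [Fin.val_zero] at key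
  omega

theorem startSet_diff_adjSet :
    startSet (n + 3 + 1) \ (adjSet 0 (n + 3 + 1) ∪ adjSet 1 (n + 3 + 1)) =
      insertPoint 0 ⟨1, by omega⟩ ''
        {σ : Equiv.Perm (Fin (n + 3)) | IsSimple σ ∧ InA σ ∧ (σ 1 : ℕ) = 0} := by
  have hpos : ∀ i : Fin (n + 3), ((0 : Fin (n + 3 + 1)).succAbove i : ℕ) = i + 1 := fun i => by
    rw [val_succAbove, if_neg (by simp)]
  have hval : ∀ (σ : Equiv.Perm (Fin (n + 3))) (i : Fin (n + 3)),
      (insertPoint 0 ⟨1, by omega⟩ σ ((0 : Fin (n + 3 + 1)).succAbove i) : ℕ) =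
      if (σ i : ℕ) < 1 then (σ i : ℕ) else σ i + 1 := fun σ i => by
    rw [insertPoint_succAbove, val_succAbove]
  have hone : 1 < n + 3 + 1 := by omega
  ext π
  constructor
  · rintro ⟨⟨hs, hA, h0⟩, hnot⟩
    have h0 := h0 0 (Fin.val_zero _)
    obtain ⟨σ, rfl⟩ := exists_eq_insertPoint (v := ⟨1, hone⟩) (Fin.ext h0)
    have hσs : IsSimple σ := by
      refine isSimple_of_insertPoint_zero rfl hs hA fun k q hk hq => ?_
      by_contra hcon
      have hk' := hval σ k
      have hq' := hval σ q
      rw [hk, if_pos (by omega)] at hk'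
      rw [hq, if_neg (by omega)] at hq'
      apply hnot
      by_cases hc : (q : ℕ) + 1 = k
      · exact Or.inl ⟨⟨hs, hA, fun i hi => by rwa [show i = 0 from Fin.ext hi]⟩,
          _, _, hk', hq', by rw [hpos, hpos]; omega⟩
      · exact Or.inr ⟨⟨hs, hA, fun i hi => by rwa [show i = 0 from Fin.ext hi]⟩,
          _, _, hk', hq', by rw [hpos, hpos]; omega⟩
    refine ⟨σ, ⟨hσs, hA.of_insertPoint, ?_⟩, rfl⟩
    rcases apply_zero_eq_one_or_apply_one_eq_zero hσs hA.of_insertPoint with h | h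
    · exfalso
      refine hs.not_adjacent (i := 0) (j := (0 : Fin (n + 3 + 1)).succAbove 0) ?_ (Or.inl ?_)
      · rw [hpos]
        simp
      · rw [hval, h, h0]
        simp
    · exact h
  · rintro ⟨σ, ⟨hs, hA, h1⟩, rfl⟩
    have hσ0 := hs.apply_zero_ne_zero
    have hσ1 : (σ 0 : ℕ) ≠ 1 := fun e =>
      hs.not_adjacent (i := 0) (j := 1) (by simp) (Or.inr (by omega))
    have hins : IsSimple (insertPoint 0 ⟨1, by omega⟩ σ) :=
      hs.insertPoint (by simp) (by simp) (fun i hi => by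
        have : i = 0 := Fin.ext (by simpa [eq_comm] using hi)
        subst this
        simp only
        omega)
    refine ⟨⟨hins, hA.insertPoint_zero rfl, fun i hi => ?_⟩, ?_⟩
    · rw [show i = 0 from Fin.ext hi, insertPoint_self]
    · have hcon : ∀ c, c ≤ 1 → ∀ k q : Fin (n + 3 + 1),
          (insertPoint 0 ⟨1, by omega⟩ σ k : ℕ) = 0 →
          (insertPoint 0 ⟨1, by omega⟩ σ q : ℕ) = 2 → (q : ℕ) + 1 = k + 2 * c → False := by
        intro c hc k q hk hq hkq
        obtain rfl | ⟨k, rfl⟩ := Fin.eq_self_or_eq_succAbove 0 k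
        · simp at hk
        obtain rfl | ⟨q, rfl⟩ := Fin.eq_self_or_eq_succAbove 0 q
        · simp at hq
        rw [hval] at hk hq
        rw [hpos, hpos] at hkq
        split_ifs at hk hq <;> try omega
        rcases Nat.le_one_iff_eq_zero_or_eq_one.1 hc with rfl | rfl
        · exact hs.not_adjacent (i := q) (j := k) (by omega) (by omega)
        · exact hs.not_adjacent (i := k) (j := q) (by omega) (by omega)
      rintro (⟨-, k, q, hk, hq, hkq⟩ | ⟨-, k, q, hk, hq, hkq⟩)
      · exact hcon 0 (by omega) k q hk hq hkq
      · exact hcon 1 (by omega) k q hk hq hkq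

theorem ncard_apply_one_eq_zero :
    {σ : Equiv.Perm (Fin (n + 3)) | IsSimple σ ∧ InA σ ∧ (σ 1 : ℕ) = 0}.ncard =
      (startSet (n + 3)).ncard := by
  have hinj : Function.Injective (Equiv.symm : Equiv.Perm (Fin (n + 3)) → _) :=
    Equiv.symm_bijective.injective
  rw [← Set.ncard_image_of_injective _ hinj]
  congr 1
  ext π
  constructor
  · rintro ⟨σ, ⟨hs, hA, h1⟩, rfl⟩
    refine ⟨hs.symm, hA.symm, fun i hi => ?_⟩
    have : i = σ 1 := Fin.ext (hi.trans h1.symm)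
    rw [this, Equiv.symm_apply_apply]
    simp
  · rintro ⟨hs, hA, h0⟩
    refine ⟨π.symm, ⟨hs.symm, hA.symm, ?_⟩, Equiv.symm_symm π⟩
    have : π 0 = 1 := Fin.ext (by rw [h0 0 (Fin.val_zero _)]; simp)
    rw [← this, Equiv.symm_apply_apply, Fin.val_zero]

theorem adjSet_disjoint (N : ℕ) : Disjoint (adjSet 0 N) (adjSet 1 N) := by
  rw [Set.disjoint_left]
  rintro π ⟨-, k, q, hk, hq, h⟩ ⟨-, k', q', hk', hq', h'⟩
  have e1 : k = k' := eq_of_apply_val π (hk.trans hk'.symm)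
  have e2 : q = q' := eq_of_apply_val π (hq.trans hq'.symm)
  subst e1 e2
  omega

theorem ncard_startSet_succ (n : ℕ) :
    (startSet (n + 3 + 1)).ncard =
      (startSet (n + 3)).ncard + (adjSet 0 (n + 3 + 1)).ncard + (adjSet 1 (n + 3 + 1)).ncard := by
  have hsub : adjSet 0 (n + 3 + 1) ∪ adjSet 1 (n + 3 + 1) ⊆ startSet (n + 3 + 1) :=
    Set.union_subset (fun _ h => h.1) (fun _ h => h.1)
  have h1 := Set.ncard_sdiff_add_ncard_of_subset hsub (Set.toFinite _)
  rw [Set.ncard_union_eq (adjSet_disjoint _) (Set.toFinite _) (Set.toFinite _),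
    startSet_diff_adjSet, Set.ncard_image_of_injective _ (fun _ _ h => (insertPoint_inj h).2),
    ncard_apply_one_eq_zero] at h1
  omega

end Counting

section NearInsertion

variable {n : ℕ}

theorem IsSimple.two_le_of_apply_eq_zero {σ : Equiv.Perm (Fin (n + 3))} (hs : IsSimple σ)
    (h0 : (σ 0 : ℕ) = 1) {k : Fin (n + 3)} (hk : (σ k : ℕ) = 0) : 2 ≤ (k : ℕ) := by
  by_contra! hlt
  have h1 : (k : ℕ) ≠ 0 := fun e => by
    rw [show k = 0 from Fin.ext e] at hk
    omega
  exact hs.not_adjacent (i := 0) (j := k) (by rw [Fin.val_zero]; omega) (by omega)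

theorem isSimple_insertPoint_near {c : ℕ} (hc : c ≤ 1) {σ : Equiv.Perm (Fin (n + 3 + 1))}
    (hσ : σ ∈ startSet (n + 3 + 1)) (hadj : σ ∉ adjSet c (n + 3 + 1)) {k : Fin (n + 3 + 1)}
    (hk : (σ k : ℕ) = 0) {p v : Fin (n + 3 + 1 + 1)} (hp : (p : ℕ) = k + c) (hv : (v : ℕ) = 2) :
    IsSimple (insertPoint p v σ) := by
  have h0 := hσ.2.2 0 (Fin.val_zero _)
  have hk2 := IsSimple.two_le_of_apply_eq_zero (n := n + 1) hσ.1 h0 hk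
  refine hσ.1.insertPoint (by omega) (by omega) fun i hi => ⟨fun e => ?_, fun e => ?_⟩
  · have : i = 0 := eq_of_apply_val σ (by omega)
    rw [this, Fin.val_zero] at hi
    omega
  · have hik : (i : ℕ) ≠ k := fun e' => by
      rw [Fin.ext e'] at e
      omega
    exact hadj ⟨hσ, k, i, hk, by omega, by omega⟩

theorem val_succAbove_succAbove_zero (p : Fin (n + 2)) (i : Fin n) :
    (p.succAbove ((0 : Fin (n + 1)).succAbove i) : ℕ) =
      if (i : ℕ) + 1 < p then (i : ℕ) + 1 else i + 2 := by
  simp [val_succAbove]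

theorem val_insertPoint_insertPoint_zero {τ : Equiv.Perm (Fin n)} {u : Fin (n + 1)}
    {v : Fin (n + 2)} (hu : (u : ℕ) = 1) (hv : (v : ℕ) = 2) (p : Fin (n + 2)) (i : Fin n) :
    (insertPoint p v (insertPoint 0 u τ) (p.succAbove ((0 : Fin (n + 1)).succAbove i)) : ℕ) =
      if (τ i : ℕ) < 1 then (τ i : ℕ) else τ i + 2 := by
  rw [insertPoint_succAbove, insertPoint_succAbove, val_succAbove, val_succAbove, hu, hv]
  split_ifs <;> omega

theorem isSimple_insertPoint_insertPoint {c : ℕ} (hc : c ≤ 1) {τ : Equiv.Perm (Fin (n + 3))}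
    (hs : IsSimple τ) (h0 : (τ 0 : ℕ) = 1) {k : Fin (n + 3)} (hk : (τ k : ℕ) = 0)
    {u : Fin (n + 3 + 1)} {p v : Fin (n + 3 + 1 + 1)} (hu : (u : ℕ) = 1)
    (hp : (p : ℕ) = k + 1 + c) (hv : (v : ℕ) = 2) :
    IsSimple (insertPoint p v (insertPoint 0 u τ)) := by
  have hk2 := hs.two_le_of_apply_eq_zero h0 hk
  refine isSimple_of_bounds fun a b x y hab hb hxy H => ?_
  have Hp := H p
  have H0 := H (p.succAbove 0)
  rw [insertPoint_self, hv] at Hp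
  rw [insertPoint_succAbove, insertPoint_self, val_succAbove, val_succAbove, hv, hu,
    Fin.val_zero, if_pos (by omega), if_pos (by omega)] at H0
  have Hi : ∀ i : Fin (n + 3), _ := fun i => H (p.succAbove ((0 : Fin (n + 3 + 1)).succAbove i))
  simp only [val_succAbove_succAbove_zero, val_insertPoint_insertPoint_zero hu hv] at Hi
  have Hz := Hi 0
  have Hk := Hi k
  rw [h0, Fin.val_zero, if_pos (by omega), if_neg (by omega)] at Hz
  rw [hk, if_pos (zero_lt_one' ℕ)] at Hk
  set a' := if a ≤ 1 then 0 else if a ≤ (p : ℕ) then a - 1 else a - 2 with ha'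
  set b' := if b < (p : ℕ) then b - 1 else b - 2 with hb'
  rcases lt_or_ge a' b' with hlt | hge
  · have key := hs.bounds (a := a') (b := b') (c := if x = 0 then 0 else max 1 (x - 2))
      (d := if y ≤ 2 then 0 else y - 2) hlt (by split_ifs at hb' <;> omega)
      (fun i => by
        have := Hi i
        split_ifs at this ha' hb' ⊢ <;> omega)
    split_ifs at Hk ha' hb' <;> omega
  · exfalso
    by_cases hpin : a ≤ (p : ℕ) ∧ (p : ℕ) ≤ b
    · have hkout : ¬ (a ≤ (if (k : ℕ) + 1 < p then (k : ℕ) + 1 else k + 2) ∧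
          (if (k : ℕ) + 1 < p then (k : ℕ) + 1 else k + 2) ≤ b) := by
        split_ifs at ha' hb' Hk ⊢ <;> omega
      have hin : k + 2 * c - 1 < n + 3 := by
        split_ifs at ha' hb' hkout <;> omega
      have hw := Hi ⟨k + 2 * c - 1, hin⟩
      have h1 : (τ ⟨k + 2 * c - 1, hin⟩ : ℕ) ≠ 0 := fun e => by
        have := congrArg Fin.val (eq_of_apply_val τ (e.trans hk.symm))
        simp only at this
        omega
      have h2 : (τ ⟨k + 2 * c - 1, hin⟩ : ℕ) ≠ 1 := fun e => by
        have := congrArg Fin.val (eq_of_apply_val τ (e.trans h0.symm))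
        simp only [Fin.val_zero] at this
        omega
      simp only at hw
      generalize (τ ⟨k + 2 * c - 1, hin⟩ : ℕ) = t at *
      split_ifs at ha' hb' hkout hw <;> omega
    · split_ifs at ha' hb' <;> omega

theorem isSimple_of_insertPoint_near {c : ℕ} (hc : c ≤ 1) {σ : Equiv.Perm (Fin (n + 3 + 1))}
    {p v : Fin (n + 3 + 1 + 1)} (hv : (v : ℕ) = 2) (hs : IsSimple (insertPoint p v σ))
    (h0 : (σ 0 : ℕ) = 1) (h1 : (σ 1 : ℕ) ≠ 2) {k : Fin (n + 3 + 1)} (hk : (σ k : ℕ) = 0)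
    (hp : (p : ℕ) = k + c) : IsSimple σ := by
  refine isSimple_of_bounds fun a b x y hab hb hxy H => ?_
  have Hk := H k
  have H0 := H 0
  have H1 := H 1
  have hk0 : (k : ℕ) ≠ 0 := fun e => by
    rw [show k = 0 from Fin.ext e] at hk
    omega
  rw [Fin.val_zero] at H0
  rw [Fin.val_one] at H1
  have hlift : ∀ a' b' x' y' : ℕ, a' < b' → b' < n + 3 + 1 + 1 →
      ((a' ≤ (p : ℕ) ∧ (p : ℕ) ≤ b') ↔ (x' ≤ 2 ∧ 2 ≤ y')) →
      (∀ i : Fin (n + 3 + 1), ((a' ≤ (if (i : ℕ) < p then (i : ℕ) else i + 1) ∧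
        (if (i : ℕ) < p then (i : ℕ) else i + 1) ≤ b') ↔
        (x' ≤ (if (σ i : ℕ) < 2 then (σ i : ℕ) else σ i + 1) ∧
          (if (σ i : ℕ) < 2 then (σ i : ℕ) else σ i + 1) ≤ y'))) →
      a' = 0 ∧ b' + 1 = n + 3 + 1 + 1 := fun a' b' x' y' hab' hb' h h' =>
    hs.bounds (c := x') (d := y') hab' hb' ((Fin.forall_iff_succAbove p).2
      ⟨by rwa [insertPoint_self, hv], fun i => by
        rw [insertPoint_succAbove, val_succAbove, val_succAbove, hv]
        exact h' i⟩)
  rcases Nat.eq_zero_or_pos x with hx | hx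
  · have := hlift a (b + 1) 0 (y + 1) (by omega) (by omega) (by omega) (fun i => by
      have := H i
      split_ifs <;> omega)
    omega
  by_cases hx1 : x = 1
  · have ha : a = 0 := by omega
    by_cases hb1 : b = 1
    · exfalso
      obtain ⟨j, hj⟩ := exists_apply_val σ (v := 2) (by omega)
      have Hj := H j
      have hj0 : (j : ℕ) ≠ 0 := fun e => by
        rw [show j = 0 from Fin.ext e] at hj
        omega
      have hj1 : (j : ℕ) ≠ 1 := fun e => by
        rw [show j = 1 from Fin.ext (by rw [e, Fin.val_one])] at hj
        omega
      omega
    · have := hlift 1 b 3 (y + 1) (by omega) (by omega) (by omega) (fun i => by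
        have := H i
        have hi : (i : ℕ) = 0 ↔ (σ i : ℕ) = 1 :=
          ⟨fun e => by rw [show i = 0 from Fin.ext e, h0], fun e => by
            rw [eq_of_apply_val σ (e.trans h0.symm), Fin.val_zero]⟩
        split_ifs <;> omega)
      omega
  · have := hlift (if a < (p : ℕ) then a else a + 1) (if b < (p : ℕ) then b else b + 1)
      (x + 1) (y + 1) (by split_ifs <;> omega) (by split_ifs <;> omega)
      (by split_ifs <;> omega) (fun i => by
        have := H i
        split_ifs <;> omega)
    obtain ⟨h, -⟩ := this
    split_ifs at h
    omega

theorem isSimple_of_insertPoint_insertPoint {c : ℕ} (hc : c ≤ 1) {τ : Equiv.Perm (Fin (n + 3))}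
    {u : Fin (n + 3 + 1)} {p v : Fin (n + 3 + 1 + 1)} (hu : (u : ℕ) = 1) (hv : (v : ℕ) = 2)
    (hs : IsSimple (insertPoint p v (insertPoint 0 u τ))) (h0 : (τ 0 : ℕ) = 1)
    {k : Fin (n + 3)} (hk : (τ k : ℕ) = 0) (hp : (p : ℕ) = k + 1 + c) : IsSimple τ := by
  refine isSimple_of_bounds fun a b x y hab hb hxy H => ?_
  have Hk := H k
  have H0 := H 0
  rw [Fin.val_zero] at H0
  have hlift : ∀ a' b' x' y' : ℕ, a' < b' → b' < n + 3 + 1 + 1 →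
      ((a' ≤ (p : ℕ) ∧ (p : ℕ) ≤ b') ↔ (x' ≤ 2 ∧ 2 ≤ y')) →
      ((a' ≤ 0 ∧ 0 ≤ b') ↔ (x' ≤ 1 ∧ 1 ≤ y')) →
      (∀ i : Fin (n + 3), ((a' ≤ (if (i : ℕ) + 1 < p then (i : ℕ) + 1 else i + 2) ∧
        (if (i : ℕ) + 1 < p then (i : ℕ) + 1 else i + 2) ≤ b') ↔
        (x' ≤ (if (τ i : ℕ) < 1 then (τ i : ℕ) else τ i + 2) ∧
          (if (τ i : ℕ) < 1 then (τ i : ℕ) else τ i + 2) ≤ y'))) →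
      a' = 0 ∧ b' + 1 = n + 3 + 1 + 1 := fun a' b' x' y' hab' hb' h h' h'' =>
    hs.bounds (c := x') (d := y') hab' hb' ((Fin.forall_iff_succAbove p).2
      ⟨by rwa [insertPoint_self, hv], (Fin.forall_iff_succAbove 0).2 ⟨by
        rw [insertPoint_succAbove, insertPoint_self, val_succAbove, val_succAbove, hv, hu,
          Fin.val_zero, if_pos (by omega), if_pos (by omega)]
        exact h', fun i => by
        have := h'' i
        rwa [val_succAbove_succAbove_zero, val_insertPoint_insertPoint_zero hu hv]⟩⟩)
  rcases Nat.eq_zero_or_pos x with hx | hx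
  · have := hlift 0 (b + 2) 0 (y + 2) (by omega) (by omega) (by omega) (by omega) (fun i => by
      have := H i
      split_ifs <;> omega)
    omega
  · have := hlift (if a + 1 < (p : ℕ) then a + 1 else a + 2)
      (if b + 1 < (p : ℕ) then b + 1 else b + 2)
      (x + 2) (y + 2) (by split_ifs <;> omega) (by split_ifs <;> omega)
      (by split_ifs <;> omega) (by split_ifs <;> omega) (fun i => by
        have := H i
        split_ifs <;> omega)
    obtain ⟨h, -⟩ := this
    split_ifs at h

end NearInsertion

section Recurrence

variable {n : ℕ}

/-- Insert a new third smallest entry immediately to the left (`c = 0`) or immediately to the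
right (`c = 1`) of the least entry. -/
def nearInsert (c : ℕ) (σ : Equiv.Perm (Fin (n + 3 + 1))) : Equiv.Perm (Fin (n + 3 + 1 + 1)) :=
  insertPoint (Fin.ofNat (n + 3 + 1 + 1) (σ.symm 0 + c)) ⟨2, by omega⟩ σ

theorem nearInsert_injective (c : ℕ) :
    Function.Injective (nearInsert c : Equiv.Perm (Fin (n + 3 + 1)) → _) :=
  fun _ _ h => (insertPoint_inj h).2

theorem nearInsert_eq {c : ℕ} {σ : Equiv.Perm (Fin (n + 3 + 1))} {k : Fin (n + 3 + 1)}
    (hk : (σ k : ℕ) = 0) {p : Fin (n + 3 + 1 + 1)} (hp : (p : ℕ) = k + c) :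
    nearInsert c σ = insertPoint p ⟨2, by omega⟩ σ := by
  have hk' : σ.symm 0 = k := by
    rw [Equiv.symm_apply_eq]
    exact Fin.ext hk.symm
  have : Fin.ofNat (n + 3 + 1 + 1) (σ.symm 0 + c) = p := Fin.ext (by
    rw [hk', Fin.val_ofNat, ← hp, Nat.mod_eq_of_lt p.2])
  rw [nearInsert, this]

theorem insertPoint_near_mem_adjSet {c : ℕ} (hc : c ≤ 1) {σ : Equiv.Perm (Fin (n + 3 + 1))}
    (h0 : (σ 0 : ℕ) = 1) (hA : InA σ) {k : Fin (n + 3 + 1)} (hk : (σ k : ℕ) = 0)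
    {p v : Fin (n + 3 + 1 + 1)} (hp : (p : ℕ) = k + c) (hv : (v : ℕ) = 2)
    (hs : IsSimple (insertPoint p v σ)) : insertPoint p v σ ∈ adjSet c (n + 3 + 1 + 1) := by
  have hk0 : (k : ℕ) ≠ 0 := fun e => by
    rw [show k = 0 from Fin.ext e] at hk
    omega
  refine ⟨⟨hs, hA.insertPoint_adjacent h0 hv hk (by omega), fun i hi => ?_⟩,
    p.succAbove k, p, ?_, by rw [insertPoint_self, hv], ?_⟩
  · have : i = p.succAbove 0 := Fin.ext (by
      rw [hi, val_succAbove, Fin.val_zero, if_pos (by omega)])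
    rw [this, insertPoint_succAbove, val_succAbove, h0, if_pos (by omega)]
  · rw [insertPoint_succAbove, val_succAbove, hk, if_pos (by omega)]
  · rw [val_succAbove]
    split_ifs <;> omega

theorem adjSet_eq_image {c : ℕ} (hc : c ≤ 1) :
    adjSet c (n + 3 + 1 + 1) = nearInsert c ''
      ((startSet (n + 3 + 1) \ adjSet c (n + 3 + 1)) ∪
        insertPoint 0 ⟨1, by omega⟩ '' startSet (n + 3)) := by
  have hone : 1 < n + 3 + 1 := by omega
  have htwo : 2 < n + 3 + 1 + 1 := by omega
  ext π
  constructor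
  · rintro ⟨⟨hs, hA, h0⟩, k, q, hk, hq, hkq⟩
    have h0 := h0 0 (Fin.val_zero _)
    obtain ⟨σ, rfl⟩ := exists_eq_insertPoint (v := ⟨2, htwo⟩) (Fin.ext hq)
    have hk2 := IsSimple.two_le_of_apply_eq_zero (n := n + 2) hs h0 hk
    obtain rfl | ⟨k, rfl⟩ := Fin.eq_self_or_eq_succAbove q k
    · omega
    rw [insertPoint_succAbove, val_succAbove] at hk
    rw [val_succAbove] at hkq hk2
    have hk : (σ k : ℕ) = 0 := by
      split_ifs at hk
      omega
    have hqk : (q : ℕ) = k + c := by split_ifs at hkq <;> omega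
    have hz : q.succAbove 0 = 0 := Fin.ext (by
      rw [val_succAbove, Fin.val_zero, if_pos (by split_ifs at hk2 <;> omega), Fin.val_zero])
    rw [← hz, insertPoint_succAbove, val_succAbove] at h0
    have h0 : (σ 0 : ℕ) = 1 := by
      dsimp only at h0
      split_ifs at h0 <;> omega
    refine ⟨σ, ?_, nearInsert_eq hk hqk⟩
    by_cases h1 : (σ 1 : ℕ) = 2
    · right
      obtain ⟨τ, rfl⟩ := exists_eq_insertPoint (v := ⟨1, hone⟩) (Fin.ext h0)
      obtain rfl | ⟨k, rfl⟩ := Fin.eq_self_or_eq_succAbove 0 k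
      · omega
      rw [insertPoint_succAbove, val_succAbove] at hk
      rw [val_succAbove, Fin.val_zero, if_neg (by omega)] at hqk
      rw [show (1 : Fin (n + 3 + 1)) = (0 : Fin (n + 3 + 1)).succAbove 0 from
        Fin.ext (by simp), insertPoint_succAbove, val_succAbove] at h1
      have h1 : (τ 0 : ℕ) = 1 := by
        dsimp only at h1
        split_ifs at h1 <;> omega
      have hk : (τ k : ℕ) = 0 := by
        split_ifs at hk
        omega
      refine ⟨τ, ⟨isSimple_of_insertPoint_insertPoint hc rfl rfl hs h1 hk hqk,
        hA.of_insertPoint.of_insertPoint, fun i hi => ?_⟩, rfl⟩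
      rwa [show i = 0 from Fin.ext hi]
    · left
      refine ⟨⟨isSimple_of_insertPoint_near hc rfl hs h0 h1 hk hqk, hA.of_insertPoint,
        fun i hi => by rwa [show i = 0 from Fin.ext hi]⟩, ?_⟩
      rintro ⟨-, k', r, hk', hr, hkr⟩
      obtain rfl : k = k' := eq_of_apply_val σ (hk.trans hk'.symm)
      have hval : (insertPoint q ⟨2, htwo⟩ σ (q.succAbove r) : ℕ) = 3 := by
        rw [insertPoint_succAbove, val_succAbove, hr, if_neg (by simp)]
      have hself : (insertPoint q ⟨2, htwo⟩ σ q : ℕ) = 2 := by rw [insertPoint_self]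
      have hpos := val_succAbove q r
      rcases Nat.le_one_iff_eq_zero_or_eq_one.1 hc with rfl | rfl
      · exact IsSimple.not_adjacent (n := n + 2) hs (i := q.succAbove r) (j := q)
          (by split_ifs at hpos <;> omega) (by omega)
      · exact IsSimple.not_adjacent (n := n + 2) hs (i := q) (j := q.succAbove r)
          (by split_ifs at hpos <;> omega) (by omega)
  · rintro ⟨σ, hσ | ⟨τ, ⟨hs, hA, h0⟩, rfl⟩, rfl⟩
    · obtain ⟨k, hk⟩ := exists_apply_val σ (v := 0) (by omega)
      have hlt : k + c < n + 3 + 1 + 1 := by omega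
      rw [nearInsert_eq hk (p := ⟨k + c, hlt⟩) rfl]
      exact insertPoint_near_mem_adjSet hc (hσ.1.2.2 0 (Fin.val_zero _)) hσ.1.2.1 hk rfl rfl
        (isSimple_insertPoint_near hc hσ.1 hσ.2 hk rfl rfl)
    · have h0 := h0 0 (Fin.val_zero _)
      obtain ⟨k, hk⟩ := exists_apply_val τ (v := 0) (by omega)
      have hlt : k + 1 + c < n + 3 + 1 + 1 := by omega
      have hk' : (insertPoint 0 ⟨1, hone⟩ τ ((0 : Fin (n + 3 + 1)).succAbove k) : ℕ) = 0 := by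
        rw [insertPoint_succAbove, val_succAbove, hk, if_pos (by simp)]
      have hp : k + 1 + c = (((0 : Fin (n + 3 + 1)).succAbove k : Fin (n + 3 + 1)) : ℕ) + c := by
        rw [val_succAbove, Fin.val_zero, if_neg (by omega)]
      rw [nearInsert_eq hk' (p := ⟨k + 1 + c, hlt⟩) hp]
      exact insertPoint_near_mem_adjSet hc (by rw [insertPoint_self]) (hA.insertPoint_zero rfl) hk'
        hp rfl (isSimple_insertPoint_insertPoint hc hs h0 hk rfl rfl rfl)

theorem ncard_adjSet_add {c : ℕ} (hc : c ≤ 1) (n : ℕ) :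
    (adjSet c (n + 3 + 1 + 1)).ncard + (adjSet c (n + 3 + 1)).ncard =
      (startSet (n + 3 + 1)).ncard + (startSet (n + 3)).ncard := by
  have hdisj : Disjoint (startSet (n + 3 + 1) \ adjSet c (n + 3 + 1))
      (insertPoint 0 ⟨1, by omega⟩ '' startSet (n + 3)) := by
    rw [Set.disjoint_left]
    rintro _ hσ ⟨τ, hτ, rfl⟩
    have h0 := hτ.2.2 0 (Fin.val_zero _)
    refine IsSimple.not_adjacent (n := n + 1) hσ.1.1 (i := 0)
      (j := (0 : Fin (n + 3 + 1)).succAbove 0) (by simp) (Or.inl ?_)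
    rw [insertPoint_self, insertPoint_succAbove, val_succAbove, h0, if_neg (by simp)]
  have hsub : adjSet c (n + 3 + 1) ⊆ startSet (n + 3 + 1) := fun _ h => h.1
  have h1 := Set.ncard_sdiff_add_ncard_of_subset hsub (Set.toFinite _)
  rw [adjSet_eq_image hc, Set.ncard_image_of_injective _ (nearInsert_injective c),
    Set.ncard_union_eq hdisj (Set.toFinite _) (Set.toFinite _),
    Set.ncard_image_of_injective _ (fun _ _ h => (insertPoint_inj h).2)]
  omega

theorem startSet_three : startSet 3 = ∅ := by
  rw [Set.eq_empty_iff_forall_notMem]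
  rintro π ⟨hs, -, h0⟩
  have h0 := h0 0 rfl
  obtain ⟨k, hk⟩ := exists_apply_val π (v := 0) (by omega)
  have hk2 := IsSimple.two_le_of_apply_eq_zero (n := 0) hs h0 hk
  obtain ⟨j, hj⟩ := exists_apply_val π (v := 2) (by omega)
  have hj0 : (j : ℕ) ≠ 0 := fun e => by
    rw [show j = 0 from Fin.ext e] at hj
    omega
  have hjk : (j : ℕ) ≠ k := fun e => by
    rw [Fin.ext e] at hj
    omega
  exact IsSimple.not_adjacent (n := 0) hs (i := 0) (j := j) (by rw [Fin.val_zero]; omega)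
    (by omega)

theorem adjSet_zero_four : adjSet 0 4 = ∅ := by
  rw [Set.eq_empty_iff_forall_notMem]
  rintro π ⟨⟨hs, -, h0⟩, k, q, hk, hq, hkq⟩
  have h0 := h0 0 rfl
  have hk2 := IsSimple.two_le_of_apply_eq_zero (n := 1) hs h0 hk
  have hq1 : (q : ℕ) ≠ 1 := fun e =>
    IsSimple.not_adjacent (n := 1) hs (i := 0) (j := q) (by rw [e, Fin.val_zero]) (by omega)
  obtain ⟨j, hj⟩ := exists_apply_val π (v := 3) (by omega)
  have hj0 : (j : ℕ) ≠ 0 := fun e => by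
    rw [show j = 0 from Fin.ext e] at hj
    omega
  have hjk : (j : ℕ) ≠ k := fun e => by
    rw [Fin.ext e] at hj
    omega
  have hjq : (j : ℕ) ≠ q := fun e => by
    rw [Fin.ext e] at hj
    omega
  exact IsSimple.not_adjacent (n := 1) hs (i := j) (j := q) (by omega) (by omega)

theorem Avoids.of_lt {k n : ℕ} {ρ : Equiv.Perm (Fin k)} {π : Equiv.Perm (Fin n)} (h : n < k) :
    Avoids ρ π := by
  rintro ⟨f, hf, -⟩
  have := Fintype.card_le_of_injective f hf.injective
  simp only [Fintype.card_fin] at this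
  omega

theorem ncard_startSet_four : (startSet 4).ncard = 1 := by
  rw [Set.ncard_eq_one]
  have hval : ∀ i, (insertPoint (0 : Fin 4) 1 p312 i : ℕ) = ![1, 3, 0, 2] i := by
    refine (Fin.forall_iff_succAbove 0).2 ⟨by rw [insertPoint_self]; rfl, fun i => ?_⟩
    rw [insertPoint_succAbove, p312, Equiv.ofBijective_apply]
    fin_cases i <;> rfl
  refine ⟨insertPoint (0 : Fin 4) 1 p312, Set.eq_singleton_iff_unique_mem.2 ⟨⟨?_, ?_, ?_⟩, ?_⟩⟩
  · refine isSimple_of_bounds fun a b c d hab hb hcd H => ?_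
    have H0 := H 0
    have H1 := H 1
    have H2 := H 2
    have H3 := H 3
    rw [hval] at H0 H1 H2 H3
    simp at H0 H1 H2 H3
    omega
  · exact InA.insertPoint_zero rfl ⟨Avoids.of_lt (by omega), Avoids.of_lt (by omega),
      Avoids.of_lt (by omega), Avoids.of_lt (by omega)⟩
  · intro i hi
    rw [show i = 0 from Fin.ext hi, hval]
    rfl
  · rintro π ⟨hs, -, h0⟩
    have h0 := h0 0 rfl
    have hne : ∀ i j : Fin 4, i ≠ j → (π i : ℕ) ≠ π j := fun i j h e => h (eq_of_apply_val π e)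
    have hadj : ∀ i j : Fin 4, (i : ℕ) + 1 = j →
        ¬((π i : ℕ) + 1 = π j ∨ (π j : ℕ) + 1 = π i) := fun i j h =>
      IsSimple.not_adjacent (n := 1) hs h
    have e1 := hne 0 1 (by decide)
    have e2 := hne 0 2 (by decide)
    have e3 := hne 0 3 (by decide)
    have e4 := hne 1 2 (by decide)
    have e5 := hne 1 3 (by decide)
    have e6 := hne 2 3 (by decide)
    have a1 := hadj 0 1 rfl
    have a2 := hadj 1 2 rfl
    have a3 := hadj 2 3 rfl
    have b1 := (π 1).2
    have b2 := (π 2).2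
    have b3 := (π 3).2
    have key : (π 1 : ℕ) = 3 ∧ (π 2 : ℕ) = 0 ∧ (π 3 : ℕ) = 2 := by omega
    refine Equiv.ext fun i => Fin.ext ?_
    rw [hval]
    fin_cases i
    exacts [h0, key.1, key.2.1, key.2.2]

/-- The numbers of permutations in `startSet`, and in its two adjacency subsets, by length. -/
theorem ncard_startSet_adjSet (n : ℕ) :
    4 * ((startSet (n + 3)).ncard : ℤ) = 3 ^ n - (-1) ^ n ∧
      (adjSet 0 (n + 3 + 1)).ncard = (startSet (n + 3)).ncard ∧
      (adjSet 1 (n + 3 + 1)).ncard + 2 * (startSet (n + 3)).ncard =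
        (startSet (n + 3 + 1)).ncard ∧
      4 * ((startSet (n + 3 + 1)).ncard : ℤ) = 3 ^ (n + 1) + (-1) ^ n := by
  induction n with
  | zero =>
    have h := ncard_startSet_succ 0
    have h3 : (startSet (0 + 3)).ncard = 0 := by rw [startSet_three, Set.ncard_empty]
    have h4 : (startSet (0 + 3 + 1)).ncard = 1 := ncard_startSet_four
    have hadj : (adjSet 0 (0 + 3 + 1)).ncard = 0 := by rw [adjSet_zero_four, Set.ncard_empty]
    rw [h3, h4, hadj] at h
    rw [h3, h4, hadj]
    exact ⟨by norm_num, rfl, by omega, by norm_num⟩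
  | succ n ih =>
    obtain ⟨h1, h2, h3, h4⟩ := ih
    have r := ncard_startSet_succ (n + 1)
    have r0 := ncard_adjSet_add zero_le_one n
    have r1 := ncard_adjSet_add le_rfl n
    rw [show n + 1 + 3 = n + 3 + 1 by ring] at *
    rw [pow_succ (3 : ℤ) (n + 1), pow_succ (-1 : ℤ) n]
    rw [pow_succ] at *
    generalize (3 : ℤ) ^ n = x at *
    generalize (-1 : ℤ) ^ n = y at *
    omega

end Recurrence

theorem statement_13 (n : ℕ) (hn : 4 ≤ n) :
    4 * (Nat.card {π : Equiv.Perm (Fin n) //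
          IsSimple π ∧ InA π ∧ π ⟨1, by omega⟩ ≠ ⟨0, by omega⟩} : ℤ)
      = 3 ^ (n - 3) + (-1) ^ n := by
  obtain ⟨m, rfl⟩ := Nat.exists_eq_add_of_le' (show 3 ≤ n by omega)
  have hiff : ∀ π : Equiv.Perm (Fin (m + 3)),
      (IsSimple π ∧ InA π ∧ π ⟨1, by omega⟩ ≠ ⟨0, by omega⟩) ↔ π ∈ startSet (m + 3) := by
    refine fun π => and_congr_right fun hs => and_congr_right fun hA =>
      ⟨fun h i hi => ?_, fun h e => ?_⟩
    · rw [show i = 0 from Fin.ext hi]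
      exact (apply_zero_eq_one_or_apply_one_eq_zero hs hA).resolve_right fun e => h (Fin.ext e)
    · have := hs.two_le_of_apply_eq_zero (h 0 (Fin.val_zero _)) (congrArg Fin.val e)
      simp at this
  rw [Nat.card_congr (Equiv.subtypeEquivRight hiff), Nat.card_coe_set_eq,
    (ncard_startSet_adjSet m).1, Nat.add_sub_cancel, pow_add]
  ring
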